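/- arXiv:1504.07424 — 5 statements merged into one kernel-verified Lean document; each statement's English description precedes it below -/
import Mathlib

section
/- (Rédei's theorem) Every finitely generated commutative monoid is finitely presented. Precisely: if M is a commutative monoid and φ : ℕ^e → M is a surjective monoid homomorphism, then the congruence ker φ = {(x,y) ∈ ℕ^e × ℕ^e : φ(x) = φ(y)} is generated, as a congruence on ℕ^e, by a finite subset σ ⊆ ℕ^e × ℕ^e. -/
/-- On a finitely generated commutative monoid, every congruence is generated by a finite set of
pairs. -/
theorem AddCon.exists_finite_addConGen_eq {N : Type*} [AddCommMonoid N] [AddMonoid.FG N]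
    (r : AddCon N) :
    ∃ σ : Set (N × N), σ.Finite ∧ addConGen (fun x y => (x, y) ∈ σ) = r := by
  have : IsNoetherianRing (AddMonoidAlgebra ℤ N) := Algebra.FiniteType.isNoetherianRing ℤ _
  let d : N × N → AddMonoidAlgebra ℤ N := fun p =>
    AddMonoidAlgebra.single p.1 1 - AddMonoidAlgebra.single p.2 1
  let s : Set (N × N) := {p | r p.1 p.2}
  obtain ⟨t, hts, ht⟩ := Submodule.fg_span_iff_fg_span_finset_subset (d '' s) |>.1
    (IsNoetherian.noetherian (Submodule.span (AddMonoidAlgebra ℤ N) (d '' s)))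
  obtain ⟨σ, hσs, hσ⟩ := Set.exists_subset_bijOn (s ∩ d ⁻¹' t) d
  have hdσ : d '' σ = t := by
    rw [hσ.image_eq, Set.image_inter_preimage, Set.inter_eq_right.2 hts]
  refine ⟨σ, ?_, le_antisymm (addConGen_le.2 fun x y h => (hσs h).1) fun x y hxy => ?_⟩
  · exact Set.Finite.of_finite_image (hdσ ▸ t.finite_toSet) hσ.injOn
  · set c := addConGen fun x y => (x, y) ∈ σ
    let f := AddMonoidAlgebra.mapDomainRingHom ℤ c.mk'
    have hfd (p : N × N) : f (d p) = 0 ↔ c p.1 p.2 := by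
      rw [map_sub, sub_eq_zero]
      simp [f, AddMonoidAlgebra.single_left_inj]
    have hle : Submodule.span (AddMonoidAlgebra ℤ N) (d '' s) ≤ RingHom.ker f := by
      rw [ht, ← hdσ, Submodule.span_le]
      rintro _ ⟨p, hp, rfl⟩
      exact (hfd p).2 (AddConGen.Rel.of _ _ hp)
    exact (hfd (x, y)).1 (hle (Submodule.subset_span ⟨(x, y), hxy, rfl⟩))


/-- **Rédei's theorem.** Every finitely generated commutative monoid is finitely
presented: if `φ : ℕ^e → M` is a surjective monoid homomorphism onto a commutative
monoid `M`, then the congruence `ker φ` on `ℕ^e` is generated by a finite subset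
`σ ⊆ ℕ^e × ℕ^e`. -/
theorem redei_finitely_presented (e : ℕ) (M : Type*) [AddCommMonoid M]
    (φ : (Fin e → ℕ) →+ M) (hφ : Function.Surjective φ) :
    ∃ σ : Set ((Fin e → ℕ) × (Fin e → ℕ)), σ.Finite ∧
      addConGen (fun x y => (x, y) ∈ σ) = AddCon.ker φ := by
  have : AddMonoid.FG (Fin e → ℕ) := AddCommMonoid.fg_of_wellQuasiOrderedLE
  exact AddCon.exists_finite_addConGen_eq _
end

section
/- (Grillet's theorem) Every finitely generated commutative monoid that is cancellative, reduced and torsion-free is isomorphic (as a monoid) to a submonoid of ℕ^k for some positive integer k. -/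
/-- A large multiple of a finite family of positive elements dominates any given family. -/
theorem exists_forall_lt_mul {ι K : Type*} [Field K] [LinearOrder K] [IsStrictOrderedRing K]
    (s : Finset ι) (x y : ι → K) (hx : ∀ i ∈ s, 0 < x i) : ∃ N : K, ∀ i ∈ s, y i < N * x i := by
  obtain ⟨N, hN⟩ := (s.image fun i => y i / x i).exists_le
  refine ⟨N + 1, fun i hi => ?_⟩
  rw [← div_lt_iff₀ (hx i hi)]
  exact (hN _ (Finset.mem_image_of_mem _ hi)).trans_lt (lt_add_one N)

/-- **Gordan's theorem** over an ordered field: if no nontrivial nonnegative combination of a finite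
family of vectors vanishes, then some linear form is positive on the whole family. -/
theorem exists_dual_pos_of_nonneg_combination_trivial {K ι : Type*} [Field K] [LinearOrder K]
    [IsStrictOrderedRing K] (s : Finset ι) {V : Type*} [AddCommGroup V] [Module K V] (v : ι → V)
    (hv : ∀ w : ι → K, (∀ i ∈ s, 0 ≤ w i) → ∑ i ∈ s, w i • v i = 0 → ∀ i ∈ s, w i = 0) :
    ∃ f : V →ₗ[K] K, ∀ i ∈ s, 0 < f (v i) := by
  classical
  induction s using Finset.induction_on generalizing V with
  | empty => exact ⟨0, by simp⟩
  | insert a t ha ih =>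
    have sum_update (w : ι → K) (c : K) :
        ∑ i ∈ insert a t, Function.update w a c i • v i = c • v a + ∑ i ∈ t, w i • v i := by
      rw [Finset.sum_insert ha, Function.update_self]
      congr 1
      refine Finset.sum_congr rfl fun i hi => ?_
      rw [Function.update_of_ne (ne_of_mem_of_not_mem hi ha)]
    have hv' (w : ι → K) (c : K) (hc : 0 ≤ c) (hw : ∀ i ∈ t, 0 ≤ w i)
        (h : c • v a + ∑ i ∈ t, w i • v i = 0) : c = 0 ∧ ∀ i ∈ t, w i = 0 := by
      have key := hv (Function.update w a c) (fun i hi => by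
        rcases Finset.mem_insert.1 hi with rfl | hi
        · simpa using hc
        · simpa [ne_of_mem_of_not_mem hi ha] using hw i hi) (by rw [sum_update, h])
      refine ⟨by simpa using key a (Finset.mem_insert_self a t), fun i hi => ?_⟩
      simpa [ne_of_mem_of_not_mem hi ha] using key i (Finset.mem_insert_of_mem hi)
    by_cases hq : ∀ w : ι → K, (∀ i ∈ t, 0 ≤ w i) →
        ∑ i ∈ t, w i • (K ∙ v a).mkQ (v i) = 0 → ∀ i ∈ t, w i = 0
    · obtain ⟨g, hg⟩ := ih _ hq
      have hva : v a ≠ 0 := fun h0 => one_ne_zero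
        (hv' 0 1 zero_le_one (by simp) (by simp [h0])).1
      obtain ⟨h, hh⟩ := Module.Projective.exists_dual_eq_one K hva
      obtain ⟨N, hN⟩ := exists_forall_lt_mul t (fun i => g ((K ∙ v a).mkQ (v i)))
        (fun i => -h (v i)) hg
      refine ⟨N • g ∘ₗ (K ∙ v a).mkQ + h, fun i hi => ?_⟩
      rcases Finset.mem_insert.1 hi with rfl | hi
      · have : (K ∙ v i).mkQ (v i) = 0 := by simp
        simp only [LinearMap.add_apply, LinearMap.smul_apply, LinearMap.comp_apply, this, hh]
        simp
      · simpa [neg_lt_iff_pos_add] using hN i hi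
    · push Not at hq
      obtain ⟨w, hw, hsum, j, hj, hwj⟩ := hq
      obtain ⟨f, hf⟩ := ih v fun w hw h => (hv' w 0 le_rfl hw (by simpa using h)).2
      refine ⟨f, Finset.forall_mem_insert _ _ _ |>.2 ⟨?_, hf⟩⟩
      simp only [← map_smul, ← map_sum] at hsum
      rw [Submodule.mkQ_apply, Submodule.Quotient.mk_eq_zero, Submodule.mem_span_singleton] at hsum
      obtain ⟨c, hc⟩ := hsum
      have hc_pos : 0 < c := by
        by_contra! hc0
        exact hwj ((hv' w (-c) (by linarith) hw (by rw [← hc]; simp)).2 j hj)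
      have hpos : 0 < c * f (v a) := by
        rw [← smul_eq_mul, ← map_smul, hc, map_sum]
        simp only [map_smul, smul_eq_mul]
        exact Finset.sum_pos' (fun i hi => mul_nonneg (hw i hi) (hf i hi).le)
          ⟨j, hj, mul_pos ((hw j hj).lt_of_ne' hwj) (hf j hj)⟩
      exact pos_of_mul_pos_right hpos hc_pos.le

/-- Finitely many rational numbers have a common positive denominator. -/
theorem exists_pos_nat_mul_eq_natCast {ι : Type*} (s : Finset ι) (q : ι → ℚ)
    (hq : ∀ i ∈ s, 0 ≤ q i) : ∃ D : ℕ, 0 < D ∧ ∀ i ∈ s, ∃ n : ℕ, (D : ℚ) * q i = n := by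
  refine ⟨∏ i ∈ s, (q i).den, Finset.prod_pos fun i _ => (q i).den_pos, fun i hi => ?_⟩
  obtain ⟨c, hc⟩ := Finset.dvd_prod_of_mem (fun i => (q i).den) hi
  refine ⟨c * (q i).num.toNat, ?_⟩
  have hnum : (((q i).num.toNat : ℕ) : ℚ) = (q i).num := by
    exact_mod_cast Int.toNat_of_nonneg (Rat.num_nonneg.2 (hq i hi))
  rw [hc]
  push_cast
  rw [hnum, ← Rat.mul_den_eq_num]
  ring

/-- An additive map to `ℚ` that is nonnegative on a finite generating set becomes `ℕ`-valued after
multiplication by a suitable positive integer. -/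
theorem AddMonoidHom.exists_nat_multiple {M : Type*} [AddCommMonoid M] (S : Finset M)
    (hS : AddSubmonoid.closure (S : Set M) = ⊤) (h : M →+ ℚ) (hh : ∀ x ∈ S, 0 ≤ h x) :
    ∃ D : ℕ, 0 < D ∧ ∃ g : M →+ ℕ, ∀ m, (g m : ℚ) = D * h m := by
  obtain ⟨D, hD, hn⟩ := exists_pos_nat_mul_eq_natCast S h hh
  refine ⟨D, hD, ?_⟩
  have hle : AddSubmonoid.closure (S : Set M) ≤
      (AddMonoidHom.mrange (Nat.castAddMonoidHom ℚ)).comap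
        ((AddMonoidHom.mulLeft (D : ℚ)).comp h) := by
    rw [AddSubmonoid.closure_le]
    intro x hx
    obtain ⟨n, hn⟩ := hn x hx
    exact ⟨n, hn.symm⟩
  have hex (m : M) : ∃ n : ℕ, (n : ℚ) = D * h m :=
    hle (hS ▸ AddSubmonoid.mem_top m)
  choose g hg using hex
  refine ⟨⟨⟨g, ?_⟩, ?_⟩, hg⟩
  · exact_mod_cast (by simp [hg] : (g 0 : ℚ) = 0)
  · intro a b
    exact_mod_cast (by simp [hg, mul_add] : (g (a + b) : ℚ) = g a + g b)

/-- A finitely generated cancellative torsion-free commutative monoid embeds into some `ℚⁿ`. -/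
theorem exists_injective_addMonoidHom_pi_rat (M : Type*) [AddCancelCommMonoid M] [AddMonoid.FG M]
    [IsAddTorsionFree M] : ∃ (n : ℕ) (e : M →+ (Fin n → ℚ)), Function.Injective e := by
  let e₁ : FreeAbelianGroup (Fin (AffineAddMonoid.dim M)) →+ (Fin (AffineAddMonoid.dim M) →₀ ℤ) :=
    (FreeAbelianGroup.equivFinsupp _).toAddMonoidHom
  let e₂ : (Fin (AffineAddMonoid.dim M) →₀ ℤ) →+ (Fin (AffineAddMonoid.dim M) → ℚ) :=
    { toFun x i := x i
      map_zero' := by ext; simp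
      map_add' x y := by ext; simp }
  have he₂ : Function.Injective e₂ := fun x y hxy => by
    ext i
    exact Int.cast_injective (congrFun hxy i : (x i : ℚ) = y i)
  exact ⟨_, e₂.comp (e₁.comp (AffineAddMonoid.embedding M)), he₂.comp
    ((FreeAbelianGroup.equivFinsupp _).injective.comp AffineAddMonoid.embedding_injective)⟩

/-- In a reduced monoid, a finite sum vanishes only if all its terms do. -/
theorem eq_zero_of_sum_eq_zero_of_reduced {M ι : Type*} [AddCommMonoid M]
    (hred : ∀ a b : M, a + b = 0 → a = 0 ∧ b = 0) {s : Finset ι} {x : ι → M}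
    (h : ∑ i ∈ s, x i = 0) : ∀ i ∈ s, x i = 0 := by
  classical
  intro i hi
  rw [← Finset.add_sum_erase s x hi] at h
  exact (hred _ _ h).1

/-- If a reduced torsion-free monoid embeds into a rational vector space, some linear form is
positive on any given finite set of nonzero elements. -/
theorem exists_dual_pos_of_reduced {M V : Type*} [AddCommMonoid M] [IsAddTorsionFree M]
    [AddCommGroup V] [Module ℚ V] (hred : ∀ a b : M, a + b = 0 → a = 0 ∧ b = 0)
    (e : M →+ V) (he : Function.Injective e) (S : Finset M) (hS : 0 ∉ S) :
    ∃ f : V →ₗ[ℚ] ℚ, ∀ x ∈ S, 0 < f (e x) := by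
  refine exists_dual_pos_of_nonneg_combination_trivial S e fun w hw hsum x hx => ?_
  obtain ⟨D, hD, hn⟩ := exists_pos_nat_mul_eq_natCast S w hw
  choose! n hn using hn
  have hzero : ∑ y ∈ S, n y • y = 0 := by
    apply he
    rw [map_sum, map_zero, ← smul_zero (D : ℚ), ← hsum, Finset.smul_sum]
    refine Finset.sum_congr rfl fun y hy => ?_
    rw [map_nsmul, smul_smul, hn y hy, Nat.cast_smul_eq_nsmul]
  have hnx : n x = 0 := (nsmul_eq_zero_iff.1
    (eq_zero_of_sum_eq_zero_of_reduced hred hzero x hx)).resolve_left (ne_of_mem_of_not_mem hx hS)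
  have := hn x hx
  rw [hnx, Nat.cast_zero] at this
  exact (mul_eq_zero.1 this).resolve_left (by positivity)


/-- **Grillet's theorem.** Every finitely generated commutative monoid that is
cancellative, reduced and torsion-free is isomorphic to a submonoid of `ℕ^k`
for some positive integer `k`. -/
theorem grillet (M : Type*) [AddCommMonoid M] (hfg : AddMonoid.FG M)
    (hcanc : ∀ a b c : M, a + b = a + c → b = c)
    (hred : ∀ a b : M, a + b = 0 → a = 0 ∧ b = 0)
    (htf : ∀ (n : ℕ) (a b : M), 0 < n → n • a = n • b → a = b) :
    ∃ (k : ℕ), 0 < k ∧ ∃ N : AddSubmonoid (Fin k → ℕ), Nonempty (M ≃+ N) := by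
  classical
  let _ : AddCancelCommMonoid M :=
    { ‹AddCommMonoid M› with add_left_cancel := fun a b c h => hcanc a b c h }
  have : AddMonoid.FG M := hfg
  have : IsAddTorsionFree M := ⟨fun n hn a b h => htf n a b (Nat.pos_of_ne_zero hn) h⟩
  obtain ⟨n, e, he⟩ := exists_injective_addMonoidHom_pi_rat M
  obtain ⟨S, hS⟩ := hfg.fg_top
  obtain ⟨f, hf⟩ := exists_dual_pos_of_reduced hred e he (S.erase 0) (Finset.notMem_erase 0 S)
  have hf_nonneg (x : M) (hx : x ∈ S) : 0 ≤ f (e x) := by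
    rcases eq_or_ne x 0 with rfl | hx0
    · simp
    · exact (hf x (Finset.mem_erase.2 ⟨hx0, hx⟩)).le
  have hshift (i : Fin n) : ∃ N : ℚ, ∀ x ∈ S, 0 ≤ N * f (e x) + e x i := by
    obtain ⟨N, hN⟩ := exists_forall_lt_mul (S.erase 0) (fun x => f (e x)) (fun x => -e x i) hf
    refine ⟨N, fun x hx => ?_⟩
    rcases eq_or_ne x 0 with rfl | hx0
    · simp
    · linarith [hN x (Finset.mem_erase.2 ⟨hx0, hx⟩)]
  choose N hN using hshift
  obtain ⟨D₀, hD₀, g₀, hg₀⟩ :=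
    AddMonoidHom.exists_nat_multiple S hS (f.toAddMonoidHom.comp e) hf_nonneg
  have hg (i : Fin n) := AddMonoidHom.exists_nat_multiple S hS
    ((N i • f + LinearMap.proj i).toAddMonoidHom.comp e) (by simpa using hN i)
  choose D hD g hg using hg
  let φ : M →+ (Fin (n + 1) → ℕ) := AddMonoidHom.pi (Fin.cons g₀ g)
  have hφ : Function.Injective φ := by
    intro a b hab
    have h₀ : g₀ a = g₀ b := congrFun hab 0
    have hfe : f (e a) = f (e b) := by
      have := congrArg (Nat.cast : ℕ → ℚ) h₀
      rw [hg₀, hg₀] at this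
      exact mul_left_cancel₀ (by positivity) this
    apply he
    ext i
    have hi : g i a = g i b := congrFun hab i.succ
    have := congrArg (Nat.cast : ℕ → ℚ) hi
    rw [hg, hg] at this
    have := mul_left_cancel₀ (Nat.cast_ne_zero.2 (hD i).ne') this
    simpa [hfe] using this
  exact ⟨n + 1, n.succ_pos, AddMonoidHom.mrange φ,
    ⟨AddEquiv.ofBijective φ.mrangeRestrict
      ⟨fun a b h => hφ (congrArg Subtype.val h), φ.mrangeRestrict_surjective⟩⟩⟩
end

section
/- (Herzog's correspondence) Let M ⊆ ℕ^k be an affine semigroup generated by m_1, …, m_e, let K be a field, and let ψ : K[x_1,…,x_e] → K[t_1,…,t_k] be the K-algebra homomorphism determined by x_i ↦ t^{m_i} (where t^{(n_1,…,n_k)} = t_1^{n_1}⋯t_k^{n_k}), with kernel I_M = ker ψ. Then a subset σ ⊆ ℕ^e × ℕ^e is a presentation of M if and only if I_M equals the ideal of K[x_1,…,x_e] generated by the binomials X^a − X^b for (a,b) ∈ σ (where X^{(a_1,…,a_e)} = x_1^{a_1}⋯x_e^{a_e}). -/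
/-- The factorization homomorphism `φ : ℕ^e → ℕ^k`, `φ(x) = ∑ xᵢ • mᵢ`. -/
def factorizationHom {k e : ℕ} (m : Fin e → (Fin k → ℕ)) : (Fin e → ℕ) →+ (Fin k → ℕ) where
  toFun x := ∑ i, x i • m i
  map_zero' := by simp
  map_add' x y := by
    simp [add_smul, Finset.sum_add_distrib]

/-- The `K`-algebra homomorphism `ψ : K[x_1,…,x_e] → K[t_1,…,t_k]`, `x_i ↦ t^{m_i}`. -/
noncomputable def herzogHom (k e : ℕ) (K : Type*) [Field K] (m : Fin e → Fin k → ℕ) :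
    MvPolynomial (Fin e) K →ₐ[K] MvPolynomial (Fin k) K :=
  MvPolynomial.aeval (fun i => ∏ j, MvPolynomial.X j ^ m i j)

namespace MvPolynomial

variable {n : ℕ} {K : Type*} [Field K]

theorem prod_X_pow_eq_monomial_equivFunOnFinite (a : Fin n → ℕ) :
    ∏ j, (X j : MvPolynomial (Fin n) K) ^ a j = monomial (Finsupp.equivFunOnFinite.symm a) 1 := by
  rw [monomial_eq, Finsupp.prod_fintype _ _ (fun _ => pow_zero _)]
  simp

theorem prod_X_pow_injective :
    Function.Injective fun a : Fin n → ℕ => ∏ j, (X j : MvPolynomial (Fin n) K) ^ a j := by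
  intro a b h
  simp only [prod_X_pow_eq_monomial_equivFunOnFinite] at h
  exact Finsupp.equivFunOnFinite.symm.injective (monomial_left_injective one_ne_zero h)

theorem prod_X_pow_add (a b : Fin n → ℕ) :
    ∏ j, (X j : MvPolynomial (Fin n) K) ^ (a + b) j =
      (∏ j, X j ^ a j) * ∏ j, X j ^ b j := by
  simp [pow_add, Finset.prod_mul_distrib]

/-- The congruence on exponents identifying `a` and `b` when `X^a - X^b` lies in the ideal `I`. -/
def exponentAddCon (I : Ideal (MvPolynomial (Fin n) K)) : AddCon (Fin n → ℕ) where
  r a b := (∏ j, X j ^ a j) - ∏ j, X j ^ b j ∈ I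
  iseqv :=
    { refl := fun a => by simp
      symm := fun h => by simpa using I.neg_mem h
      trans := fun h₁ h₂ => by simpa using I.add_mem h₁ h₂ }
  add' {a b c d} h₁ h₂ := by
    rw [prod_X_pow_add, prod_X_pow_add]
    have h := I.add_mem (I.mul_mem_right (∏ j, X j ^ c j) h₁)
      (I.mul_mem_left (∏ j, X j ^ b j) h₂)
    convert h using 1
    ring

theorem exists_algHom_prod_X_pow_eq_single (c : AddCon (Fin n → ℕ)) :
    ∃ F : MvPolynomial (Fin n) K →ₐ[K] AddMonoidAlgebra K c.Quotient,
      ∀ a : Fin n → ℕ, F (∏ j, X j ^ a j) = AddMonoidAlgebra.single (a : c.Quotient) 1 := by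
  let g : Multiplicative (Fin n → ℕ) →* AddMonoidAlgebra K c.Quotient :=
    (AddMonoidAlgebra.of K c.Quotient).comp c.mk'.toMultiplicative
  refine ⟨aeval fun i => g (Multiplicative.ofAdd (Pi.single i 1)), fun a => ?_⟩
  have ha : a = ∑ i, a i • (Pi.single i 1 : Fin n → ℕ) := by
    ext j
    simp [Finset.sum_apply, Pi.single_apply]
  have hg : g (Multiplicative.ofAdd a) = AddMonoidAlgebra.single (a : c.Quotient) 1 := rfl
  rw [← hg]
  conv_rhs => rw [ha, ofAdd_sum, map_prod]
  simp only [map_prod, map_pow, aeval_X, ofAdd_nsmul]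

end MvPolynomial

open MvPolynomial

theorem herzogHom_prod_X_pow {k e : ℕ} (K : Type*) [Field K] (m : Fin e → Fin k → ℕ)
    (a : Fin e → ℕ) :
    herzogHom k e K m (∏ j, X j ^ a j) = ∏ j, X j ^ factorizationHom m a j := by
  have h (j : Fin k) : factorizationHom m a j = ∑ i, m i j * a i := by
    simp [factorizationHom, Finset.sum_apply, mul_comm]
  simp only [herzogHom, map_prod, map_pow, aeval_X, h, ← Finset.prod_pow_eq_pow_sum, pow_mul,
    ← Finset.prod_pow]
  exact Finset.prod_comm

theorem prod_X_pow_sub_mem_ker_herzogHom_iff {k e : ℕ} (K : Type*) [Field K]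
    (m : Fin e → Fin k → ℕ) (a b : Fin e → ℕ) :
    (∏ j, X j ^ a j) - ∏ j, X j ^ b j ∈ RingHom.ker (herzogHom k e K m).toRingHom ↔
      factorizationHom m a = factorizationHom m b := by
  rw [RingHom.mem_ker]
  change herzogHom k e K m _ = 0 ↔ _
  rw [map_sub, herzogHom_prod_X_pow, herzogHom_prod_X_pow, sub_eq_zero]
  exact prod_X_pow_injective.eq_iff

/-- An ideal containing every binomial `X^a - X^b` with `φ a = φ b` contains `ker ψ`. -/
theorem ker_herzogHom_le {k e : ℕ} (K : Type*) [Field K] (m : Fin e → Fin k → ℕ)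
    (I : Ideal (MvPolynomial (Fin e) K))
    (hI : ∀ a b : Fin e → ℕ, factorizationHom m a = factorizationHom m b →
      (∏ j, X j ^ a j) - ∏ j, X j ^ b j ∈ I) :
    RingHom.ker (herzogHom k e K m).toRingHom ≤ I := by
  let s : (Fin k → ℕ) → Fin e → ℕ := Function.invFun (factorizationHom m)
  let L : MvPolynomial (Fin k) K →ₗ[K] MvPolynomial (Fin e) K :=
    (basisMonomials (Fin k) K).constr K fun d => ∏ j, X j ^ s d j
  have hL (b : Fin k → ℕ) : L (∏ j, X j ^ b j) = ∏ j, X j ^ s b j := by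
    rw [prod_X_pow_eq_monomial_equivFunOnFinite]
    exact (basisMonomials (Fin k) K).constr_basis K _ _
  have key (f : MvPolynomial (Fin e) K) : f - L (herzogHom k e K m f) ∈ I := by
    induction f using MvPolynomial.induction_on' with
    | monomial d r =>
      have hd : monomial d r = r • ∏ j, (X j : MvPolynomial (Fin e) K) ^ d j := by
        rw [prod_X_pow_eq_monomial_equivFunOnFinite, Finsupp.equivFunOnFinite_symm_coe,
          smul_monomial, smul_eq_mul, mul_one]
      rw [hd, map_smul, map_smul, herzogHom_prod_X_pow, hL, ← smul_sub]
      exact Submodule.smul_of_tower_mem I r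
        (hI _ _ (Function.invFun_eq (f := factorizationHom m) ⟨d, rfl⟩).symm)
    | add p q hp hq =>
      rw [map_add, map_add, add_sub_add_comm]
      exact I.add_mem hp hq
  intro f hf
  have hf' : herzogHom k e K m f = 0 := hf
  simpa [hf'] using key f

/-- **Herzog's correspondence.** For an affine semigroup `M ⊆ ℕ^k` generated by
`m_1, …, m_e`, a subset `σ ⊆ ℕ^e × ℕ^e` is a presentation of `M` (i.e. it generates
the congruence `ker φ`) if and only if the toric ideal `I_M = ker ψ` is generated by
the binomials `X^a − X^b` with `(a, b) ∈ σ`. -/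
theorem herzog_correspondence (k e : ℕ) (K : Type*) [Field K]
    (m : Fin e → Fin k → ℕ) (σ : Set ((Fin e → ℕ) × (Fin e → ℕ))) :
    (addConGen (fun x y => (x, y) ∈ σ) = AddCon.ker (factorizationHom m)) ↔
      RingHom.ker (herzogHom k e K m).toRingHom =
        Ideal.span {f : MvPolynomial (Fin e) K | ∃ p ∈ σ,
          f = (∏ j, MvPolynomial.X j ^ p.1 j) - ∏ j, MvPolynomial.X j ^ p.2 j} := by
  set I := Ideal.span {f : MvPolynomial (Fin e) K | ∃ p ∈ σ,
    f = (∏ j, MvPolynomial.X j ^ p.1 j) - ∏ j, MvPolynomial.X j ^ p.2 j} with hI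
  have hσ (p) (hp : p ∈ σ) : (∏ j, X j ^ p.1 j) - ∏ j, X j ^ p.2 j ∈ I :=
    Ideal.subset_span ⟨p, hp, rfl⟩
  have hgen {a b} (hab : (a, b) ∈ σ) : addConGen (fun x y => (x, y) ∈ σ) a b :=
    AddCon.le_addConGen (r := fun x y => (x, y) ∈ σ) _ _ hab
  constructor
  · intro h
    apply le_antisymm
    · refine ker_herzogHom_le K m I fun a b hab => ?_
      have hle : addConGen (fun x y => (x, y) ∈ σ) ≤ exponentAddCon I :=
        AddCon.addConGen_le.2 fun x y hxy => hσ (x, y) hxy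
      rw [h] at hle
      exact hle hab
    · rw [hI, Ideal.span_le]
      rintro _ ⟨p, hp, rfl⟩
      refine (prod_X_pow_sub_mem_ker_herzogHom_iff K m p.1 p.2).2 ?_
      have hp' := hgen hp
      rw [h] at hp'
      exact hp'
  · intro h
    apply le_antisymm
    · refine AddCon.addConGen_le.2 fun x y hxy => ?_
      exact (prod_X_pow_sub_mem_ker_herzogHom_iff K m x y).1 (h ▸ hσ (x, y) hxy)
    · intro a b hab
      obtain ⟨F, hF⟩ := exists_algHom_prod_X_pow_eq_single (K := K)
        (addConGen fun x y => (x, y) ∈ σ)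
      have hIF : I ≤ RingHom.ker F := by
        rw [hI, Ideal.span_le]
        rintro _ ⟨p, hp, rfl⟩
        rw [SetLike.mem_coe, RingHom.mem_ker, map_sub, hF, hF, (AddCon.eq _).2 (hgen hp), sub_self]
      have hmem := hIF (h ▸ (prod_X_pow_sub_mem_ker_herzogHom_iff K m a b).2 hab)
      rw [RingHom.mem_ker, map_sub, hF, hF, sub_eq_zero] at hmem
      exact (AddCon.eq _).1 ((AddMonoidAlgebra.single_left_inj one_ne_zero).1 hmem)
end

section
/- Let M be an affine semigroup with atoms m_1, …, m_e and let σ be a minimal presentation of M. Then M is half-factorial if and only if |a| = |b| for every pair (a, b) ∈ σ, where |x| denotes the length x_1 + ⋯ + x_e. -/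
/-- The length `|x| = x₁ + ⋯ + x_e` of a factorization. -/
def len {e : ℕ} (x : Fin e → ℕ) : ℕ := ∑ i, x i

/-- `a` is an atom (irreducible element) of `M`. -/
def IsAtomOf {k : ℕ} (M : AddSubmonoid (Fin k → ℕ)) (a : Fin k → ℕ) : Prop :=
  a ∈ M ∧ a ≠ 0 ∧ ∀ x y, x ∈ M → y ∈ M → a = x + y → x = 0 ∨ y = 0

/-- `σ` is a presentation of the affine semigroup generated by `m`. -/
def IsPresentation {k e : ℕ} (m : Fin e → (Fin k → ℕ))
    (σ : Set ((Fin e → ℕ) × (Fin e → ℕ))) : Prop :=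
  addConGen (fun x y => (x, y) ∈ σ) = AddCon.ker (factorizationHom m)

/-- A minimal presentation: a presentation minimal with respect to inclusion. -/
def IsMinimalPresentation {k e : ℕ} (m : Fin e → (Fin k → ℕ))
    (σ : Set ((Fin e → ℕ) × (Fin e → ℕ))) : Prop :=
  IsPresentation m σ ∧ ∀ τ ⊆ σ, IsPresentation m τ → τ = σ

/-- The length as an additive homomorphism. -/
def lenHom (e : ℕ) : (Fin e → ℕ) →+ ℕ where
  toFun := len
  map_zero' := by simp [len]
  map_add' x y := by simp [len, Finset.sum_add_distrib]

/-- If a presentation relates only factorizations of equal length, then all factorizations of the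
same element have equal length. -/
theorem IsPresentation.len_eq {k e : ℕ} {m : Fin e → (Fin k → ℕ)}
    {σ : Set ((Fin e → ℕ) × (Fin e → ℕ))} (hσ : IsPresentation m σ)
    (h : ∀ p ∈ σ, len p.1 = len p.2) {x y : Fin e → ℕ}
    (hxy : factorizationHom m x = factorizationHom m y) : len x = len y := by
  have hle : addConGen (fun x y => (x, y) ∈ σ) ≤ AddCon.ker (lenHom e) :=
    AddCon.addConGen_le.2 fun a b hab => h (a, b) hab
  rw [hσ] at hle
  exact hle hxy

/-- The pairs of a presentation are pairs of factorizations of the same element. -/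
theorem IsPresentation.factorizationHom_eq {k e : ℕ} {m : Fin e → (Fin k → ℕ)}
    {σ : Set ((Fin e → ℕ) × (Fin e → ℕ))} (hσ : IsPresentation m σ)
    {p : (Fin e → ℕ) × (Fin e → ℕ)} (hp : p ∈ σ) :
    factorizationHom m p.1 = factorizationHom m p.2 := by
  have hrel : addConGen (fun x y => (x, y) ∈ σ) p.1 p.2 := AddConGen.Rel.of _ _ hp
  rw [hσ] at hrel
  exact hrel

/-- Let `M` be an affine semigroup with atoms `m_1, …, m_e` and let `σ` be a
minimal presentation of `M`.  Then `M` is half-factorial (any two factorizations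
of the same element have the same length) if and only if `|a| = |b|` for every
pair `(a, b) ∈ σ`. -/
theorem half_factorial_iff_presentation_balanced (k e : ℕ)
    (m : Fin e → (Fin k → ℕ)) (M : AddSubmonoid (Fin k → ℕ))
    (hgen : AddSubmonoid.closure (Set.range m) = M)
    (hinj : Function.Injective m)
    (hatoms : ∀ i, IsAtomOf M (m i))
    (σ : Set ((Fin e → ℕ) × (Fin e → ℕ))) (hσ : IsMinimalPresentation m σ) :
    (∀ x y : Fin e → ℕ, factorizationHom m x = factorizationHom m y → len x = len y) ↔
      ∀ p ∈ σ, len p.1 = len p.2 := by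
  exact ⟨fun h p hp => h p.1 p.2 (hσ.1.factorizationHom_eq hp),
    fun h _ _ hxy => hσ.1.len_eq h hxy⟩
end

section
/- Let M be an affine semigroup that is not half-factorial (so that Δ(M) ≠ ∅). Then the minimum of the Delta set of M equals its greatest common divisor: min Δ(M) = gcd Δ(M). -/
/-- The set of factorizations `Z(n) = φ⁻¹(n)`. -/
def factsOf {k e : ℕ} (m : Fin e → (Fin k → ℕ)) (n : Fin k → ℕ) : Set (Fin e → ℕ) :=
  {x | factorizationHom m x = n}

/-- The set of lengths `L(n)`. -/
def lengthsOf {k e : ℕ} (m : Fin e → (Fin k → ℕ)) (n : Fin k → ℕ) : Set ℕ :=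
  len '' factsOf m n

/-- The Delta set `Δ(n)`: the set of gaps between consecutive lengths of
factorizations of `n`. -/
def deltaOf {k e : ℕ} (m : Fin e → (Fin k → ℕ)) (n : Fin k → ℕ) : Set ℕ :=
  {d | 0 < d ∧ ∃ l, l ∈ lengthsOf m n ∧ l + d ∈ lengthsOf m n ∧
    ∀ l', l < l' → l' < l + d → l' ∉ lengthsOf m n}

/-- The Delta set `Δ(M) = ⋃_{n ∈ M} Δ(n)` of the affine semigroup `M`. -/
def deltaSet {k e : ℕ} (m : Fin e → (Fin k → ℕ)) (M : AddSubmonoid (Fin k → ℕ)) :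
    Set ℕ :=
  {d | ∃ n ∈ M, d ∈ deltaOf m n}

/-- The group of differences of lengths of factorizations of a common element. -/
def lengthDifferences {k e : ℕ} (m : Fin e → (Fin k → ℕ)) : AddSubgroup ℤ where
  carrier := {t | ∃ x y, factorizationHom m x = factorizationHom m y ∧
    (len x : ℤ) - len y = t}
  zero_mem' := ⟨0, 0, rfl, by simp⟩
  add_mem' := by
    rintro _ _ ⟨x, y, h, rfl⟩ ⟨x', y', h', rfl⟩
    refine ⟨x + x', y + y', by rw [map_add, map_add, h, h'], ?_⟩
    simp only [len, Pi.add_apply, Finset.sum_add_distrib, Nat.cast_add]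
    ring
  neg_mem' := by
    rintro _ ⟨x, y, h, rfl⟩
    exact ⟨y, x, h.symm, by ring⟩

lemma sub_mem_lengthDifferences {k e : ℕ} {m : Fin e → (Fin k → ℕ)} {n : Fin k → ℕ} {a b : ℕ}
    (ha : a ∈ lengthsOf m n) (hb : b ∈ lengthsOf m n) :
    (a : ℤ) - b ∈ lengthDifferences m := by
  obtain ⟨x, hx, rfl⟩ := ha
  obtain ⟨y, hy, rfl⟩ := hb
  exact ⟨x, y, hx.trans hy.symm, rfl⟩

lemma mem_lengthDifferences_of_mem_deltaSet {k e : ℕ} {m : Fin e → (Fin k → ℕ)}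
    {M : AddSubmonoid (Fin k → ℕ)} {d : ℕ} (hd : d ∈ deltaSet m M) :
    (d : ℤ) ∈ lengthDifferences m := by
  obtain ⟨n, -, -, l, hl, hld, -⟩ := hd
  simpa using sub_mem_lengthDifferences hld hl

lemma factorizationHom_mem {k e : ℕ} {m : Fin e → (Fin k → ℕ)} {M : AddSubmonoid (Fin k → ℕ)}
    (hm : ∀ i, m i ∈ M) (x : Fin e → ℕ) : factorizationHom m x ∈ M :=
  sum_mem (t := Finset.univ) (f := fun i => x i • m i) fun i _ => nsmul_mem (hm i) (x i)

/-- A positive length difference dividing all length differences is an element of the Delta set. -/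
lemma mem_deltaSet_of_forall_dvd {k e : ℕ} {m : Fin e → (Fin k → ℕ)}
    {M : AddSubmonoid (Fin k → ℕ)} (hm : ∀ i, m i ∈ M) {h : ℕ} (hpos : 0 < h)
    (hmem : (h : ℤ) ∈ lengthDifferences m) (hdvd : ∀ t ∈ lengthDifferences m, (h : ℤ) ∣ t) :
    h ∈ deltaSet m M := by
  obtain ⟨x, y, hxy, hlen⟩ := hmem
  have hy : len y ∈ lengthsOf m (factorizationHom m y) := ⟨y, rfl, rfl⟩
  refine ⟨factorizationHom m y, factorizationHom_mem hm y, hpos, len y, hy,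
    ⟨x, hxy, by omega⟩, fun l hl hlt hmem => ?_⟩
  have := Int.le_of_dvd (by omega) (hdvd _ (sub_mem_lengthDifferences hmem hy))
  omega

/-- Let `M` be an affine semigroup that is not half-factorial, so `Δ(M) ≠ ∅`.
Then `min Δ(M) = gcd Δ(M)`: the minimum of `Δ(M)` is the greatest common divisor
of the elements of `Δ(M)`. -/
theorem min_delta_eq_gcd_delta (k e : ℕ) (m : Fin e → (Fin k → ℕ))
    (M : AddSubmonoid (Fin k → ℕ))
    (hgen : AddSubmonoid.closure (Set.range m) = M)
    (hinj : Function.Injective m)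
    (hatoms : ∀ i, IsAtomOf M (m i))
    (hne : (deltaSet m M).Nonempty) :
    IsGreatest {g : ℕ | ∀ d ∈ deltaSet m M, g ∣ d} (sInf (deltaSet m M)) := by
  have hm : ∀ i, m i ∈ M := fun i => (hatoms i).1
  obtain ⟨a, ha⟩ := Int.subgroup_cyclic (lengthDifferences m)
  have hdvd : ∀ t ∈ lengthDifferences m, (a.natAbs : ℤ) ∣ t := fun t ht => by
    rw [ha, ← AddSubgroup.zmultiples_eq_closure, Int.mem_zmultiples_iff] at ht
    exact Int.natAbs_dvd.mpr ht
  have hmem : (a.natAbs : ℤ) ∈ lengthDifferences m := by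
    rw [ha, ← AddSubgroup.zmultiples_eq_closure, Int.mem_zmultiples_iff]
    exact Int.dvd_natAbs.mpr dvd_rfl
  have hdvd_delta : ∀ d ∈ deltaSet m M, a.natAbs ∣ d := fun d hd =>
    Int.natCast_dvd_natCast.mp (hdvd d (mem_lengthDifferences_of_mem_deltaSet hd))
  have hpos_delta : ∀ d ∈ deltaSet m M, 0 < d := fun d ⟨_, _, hd, _⟩ => hd
  obtain ⟨d, hd⟩ := hne
  have hdelta : a.natAbs ∈ deltaSet m M :=
    mem_deltaSet_of_forall_dvd hm
      (Nat.pos_of_dvd_of_pos (hdvd_delta d hd) (hpos_delta d hd)) hmem hdvd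
  have hleast : IsLeast (deltaSet m M) a.natAbs :=
    ⟨hdelta, fun d hd => Nat.le_of_dvd (hpos_delta d hd) (hdvd_delta d hd)⟩
  rw [hleast.csInf_eq]
  exact ⟨hdvd_delta, fun g hg =>
    Nat.le_of_dvd (hpos_delta _ hdelta) (hg _ hdelta)⟩
end
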